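/- arXiv:1612.08429 — 3 statements merged into one kernel-verified Lean document; each statement's English description precedes it below -/
import Mathlib

section
/- Let μ be an acyclic partial matching on a finite graded poset P and let γ₁ ⪯ γ₂ ⪯ γ₃ be flow paths. Write τ(γ₂ ⪯ γ₃) = (e'_{k₂}, u'_{k₂}, …, e'_{n₂}, u'_{n₂}; τ(γ₂)) and τ(γ₁ ⪯ γ₂) = (e_{k₁}, u_{k₁}, …, e_{n₁}, u_{n₁}; τ(γ₁)) for the two collapses. Then the sequence (e'_{k₂}, u'_{k₂}, …, e'_{n₂}, u'_{n₂}, e_{k₁}, u_{k₁}, …, e_{n₁}, u_{n₁}; τ(γ₁)), obtained by concatenating the entries of τ(γ₂ ⪯ γ₃) with those of τ(γ₁ ⪯ γ₂) and taking target τ(γ₁), is a flow path, and τ(γ₁ ⪯ γ₃) ⪯ this flow path. (This is the colax-functoriality of the collapsing assignment.) -/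
/-- A partial matching on a poset `P`: a bijection `μ : D → U` between disjoint
subsets `D, U ⊆ P` such that `d ⋖ μ d` for every `d ∈ D`. -/
structure PartialMatching (P : Type) [PartialOrder P] where
  D : Set P
  U : Set P
  m : P → P
  minv : P → P
  disj : Disjoint D U
  m_mem : ∀ d ∈ D, m d ∈ U
  minv_mem : ∀ u ∈ U, minv u ∈ D
  left_inv : ∀ d ∈ D, minv (m d) = d
  right_inv : ∀ u ∈ U, m (minv u) = u
  cov : ∀ d ∈ D, d ⋖ m d

namespace PartialMatching

variable {P : Type} [PartialOrder P]

/-- The set of critical elements. -/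
def Cr (M : PartialMatching P) : Set P := (M.D ∪ M.U)ᶜ

/-- A partial matching is acyclic if every Forman path is a gradient path. -/
def IsAcyclic (M : PartialMatching P) : Prop :=
  ∀ (n : ℕ) (d : ℕ → P), 1 ≤ n →
    (∀ i j, i < n → j < n → d i = d j → i = j) →
    (∀ i, i < n → d i ∈ M.D) →
    (∀ i, i + 1 < n → d (i + 1) ⋖ M.m (d i)) →
    n = 1 ∨ ¬ d 0 ⋖ M.m (d (n - 1))

/-- A faithful discrete Morse function adapted to `M`. -/
def Faithful (M : PartialMatching P) (f : P → ℤ) : Prop :=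
  Function.Injective f ∧
  (∀ d ∈ M.D, f (M.m d) < f d) ∧
  ∀ e e' : P, e < e' → ¬(e ∈ M.D ∧ e' = M.m e) → f e < f e'

end PartialMatching

/-- The data of a flow path `(e₁,u₁,…,e_n,u_n;c)`: the list of pairs
`steps = [(e₁,u₁),…,(e_n,u_n)]` and the final (critical) cell `c`. -/
structure FlowPath (P : Type) where
  steps : List (P × P)
  c : P

namespace FlowPath

variable {P : Type} [PartialOrder P]

/-- The length `ℓ(γ) = n` of a flow path. -/
def len (γ : FlowPath P) : ℕ := γ.steps.length

/-- `eAt γ i = e_{i+1}` (0-based); by convention `eAt γ i = c` for `i ≥ len γ`. -/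
def eAt (γ : FlowPath P) (i : ℕ) : P := (γ.steps.map Prod.fst).getD i γ.c

/-- `uAt γ i = u_{i+1}` (0-based). -/
def uAt (γ : FlowPath P) (i : ℕ) : P := (γ.steps.map Prod.snd).getD i γ.c

/-- The initial cell `ι(γ)` (equal to `c` when `len γ = 0`). -/
def init (γ : FlowPath P) : P := γ.eAt 0

/-- The target `τ(γ) = c`. -/
def tgt (γ : FlowPath P) : P := γ.c

/-- `γ` is a genuine flow path with respect to the matching `M`. -/
def Valid (M : PartialMatching P) (γ : FlowPath P) : Prop :=
  γ.c ∈ M.Cr ∧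
  ∀ i, i < γ.len →
    γ.uAt i ∈ M.U ∧
    (γ.eAt i = γ.uAt i ∨ γ.eAt i = M.minv (γ.uAt i)) ∧
    γ.eAt (i + 1) < γ.uAt i ∧
    γ.eAt (i + 1) ≠ M.minv (γ.uAt i)

/-- `φ : {0,…,k} → {0,…,ℓ(γ')+1}` is an embedding function for `γ ⪯ γ'`.
Indices of cells are 1-based as in the paper, so the paper's `e_j` is `eAt γ (j-1)`. -/
def IsEmbed (γ γ' : FlowPath P) (k : ℕ) (φ : ℕ → ℕ) : Prop :=
  1 ≤ k ∧ k ≤ γ.len + 1 ∧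
  (∀ i j, i < j → j ≤ k → φ i < φ j) ∧
  φ 0 = 0 ∧ φ k = γ'.len + 1 ∧
  (∀ j, 1 ≤ j → j < k → γ.uAt (j - 1) = γ'.uAt (φ j - 1)) ∧
  (∀ j p, 1 ≤ j → j ≤ k → φ (j - 1) < p → p ≤ φ j → γ.eAt (j - 1) ≤ γ'.eAt (p - 1))

/-- The subpath relation `γ ⪯ γ'`. -/
def Subpath (γ γ' : FlowPath P) : Prop := ∃ k φ, IsEmbed γ γ' k φ

/-- `γ` is reducible at `i` (0-based; the paper's index is `i+1`). -/
def ReducibleAt (M : PartialMatching P) (γ : FlowPath P) (i : ℕ) : Prop :=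
  i < γ.len ∧ γ.eAt (i + 1) < M.minv (γ.uAt i)

/-- `γ` is reduced: it is reducible at no index. -/
def Reduced (M : PartialMatching P) (γ : FlowPath P) : Prop :=
  ∀ i, ¬ ReducibleAt M γ i

/-- Concatenation `γ * δ` of flow paths. -/
def concat (γ δ : FlowPath P) : FlowPath P := ⟨γ.steps ++ δ.steps, δ.c⟩

/-- The collapse `τ(γ ⪯ γ')`: the tail of `γ` starting at its (1-based) `k`-th cell. -/
def collapse (γ : FlowPath P) (k : ℕ) : FlowPath P := ⟨γ.steps.drop (k - 1), γ.c⟩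

/-- `rγ` is the reduction of `γ`: the greatest reduced flow path `⪯ γ`. -/
def IsReduction (M : PartialMatching P) (γ rγ : FlowPath P) : Prop :=
  Valid M rγ ∧ Reduced M rγ ∧ Subpath rγ γ ∧
  ∀ δ, Valid M δ → Reduced M δ → Subpath δ γ → Subpath δ rγ

end FlowPath

namespace PartialMatching

variable {P : Type} [PartialOrder P]

theorem minv_covBy (M : PartialMatching P) {u : P} (hu : u ∈ M.U) : M.minv u ⋖ u := by
  simpa only [M.right_inv u hu] using M.cov _ (M.minv_mem u hu)

theorem ne_minv_of_le (M : PartialMatching P) {u e x : P} (hu : u ∈ M.U) (hex : e ≤ x)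
    (hxu : x < u) (hx : x ≠ M.minv u) : e ≠ M.minv u := by
  rintro rfl
  exact (M.minv_covBy hu).2 (lt_of_le_of_ne hex hx.symm) hxu

end PartialMatching

namespace FlowPath

variable {P : Type}

theorem len_collapse (γ : FlowPath P) (k : ℕ) : (γ.collapse k).len = γ.len - (k - 1) := by
  simp [len, collapse]

theorem eAt_collapse (γ : FlowPath P) (k i : ℕ) :
    (γ.collapse k).eAt i = γ.eAt (k - 1 + i) := by
  simp [eAt, collapse, List.getD_eq_getElem?_getD, List.getElem?_drop]

theorem uAt_collapse (γ : FlowPath P) (k i : ℕ) :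
    (γ.collapse k).uAt i = γ.uAt (k - 1 + i) := by
  simp [uAt, collapse, List.getD_eq_getElem?_getD, List.getElem?_drop]

theorem len_concat (γ δ : FlowPath P) : (γ.concat δ).len = γ.len + δ.len := by
  simp [len, concat]

theorem eAt_concat_left (γ δ : FlowPath P) {i : ℕ} (h : i < γ.len) :
    (γ.concat δ).eAt i = γ.eAt i := by
  have h' : i < γ.steps.length := h
  simp [eAt, concat, List.getD_eq_getElem?_getD, List.getElem?_append_left, h']

theorem uAt_concat_left (γ δ : FlowPath P) {i : ℕ} (h : i < γ.len) :
    (γ.concat δ).uAt i = γ.uAt i := by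
  have h' : i < γ.steps.length := h
  simp [uAt, concat, List.getD_eq_getElem?_getD, List.getElem?_append_left, h']

theorem eAt_concat_right (γ δ : FlowPath P) {i : ℕ} (h : γ.len ≤ i) :
    (γ.concat δ).eAt i = δ.eAt (i - γ.len) := by
  have h' : γ.steps.length ≤ i := h
  simp [eAt, concat, len, List.getD_eq_getElem?_getD, List.getElem?_append_right, h']

theorem uAt_concat_right (γ δ : FlowPath P) {i : ℕ} (h : γ.len ≤ i) :
    (γ.concat δ).uAt i = δ.uAt (i - γ.len) := by
  have h' : γ.steps.length ≤ i := h
  simp [uAt, concat, len, List.getD_eq_getElem?_getD, List.getElem?_append_right, h']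

theorem eAt_len (γ : FlowPath P) : γ.eAt γ.len = γ.c := by
  simp [eAt, len, List.getD_eq_getElem?_getD]

variable [PartialOrder P]

theorem Valid.collapse {M : PartialMatching P} {γ : FlowPath P} (h : γ.Valid M) (k : ℕ) :
    (γ.collapse k).Valid M := by
  refine ⟨h.1, fun i hi => ?_⟩
  rw [len_collapse] at hi
  simpa only [eAt_collapse, uAt_collapse, add_assoc] using h.2 (k - 1 + i) (by omega)

/-- Valid flow paths can be concatenated when the second starts below the target of the first. -/
theorem Valid.concat {M : PartialMatching P} {γ δ : FlowPath P} (hγ : γ.Valid M)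
    (hδ : δ.Valid M) (h : δ.init ≤ γ.tgt) : (γ.concat δ).Valid M := by
  refine ⟨hδ.1, fun i hi => ?_⟩
  rw [len_concat] at hi
  rcases lt_or_ge i γ.len with hiγ | hiγ
  · obtain ⟨hu, he, hlt, hne⟩ := hγ.2 i hiγ
    rw [uAt_concat_left _ _ hiγ, eAt_concat_left _ _ hiγ]
    refine ⟨hu, he, ?_⟩
    rcases lt_or_ge (i + 1) γ.len with hi' | hi'
    · rw [eAt_concat_left _ _ hi']
      exact ⟨hlt, hne⟩
    · have hlen : i + 1 = γ.len := by omega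
      rw [eAt_concat_right _ _ hi', hlen, Nat.sub_self]
      rw [hlen, eAt_len] at hlt hne
      exact ⟨lt_of_le_of_lt h hlt, M.ne_minv_of_le hu h hlt hne⟩
  · rw [uAt_concat_right _ _ hiγ, eAt_concat_right _ _ hiγ, eAt_concat_right _ _ (by omega),
      Nat.sub_add_comm hiγ]
    exact hδ.2 _ (by omega)

theorem IsEmbed.le_of_le {γ γ' : FlowPath P} {k : ℕ} {φ : ℕ → ℕ} (h : γ.IsEmbed γ' k φ)
    {i j : ℕ} (hij : i ≤ j) (hj : j ≤ k) : φ i ≤ φ j := by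
  rcases hij.eq_or_lt with rfl | hlt
  · exact le_rfl
  · exact (h.2.2.1 i j hlt hj).le

/-- Two embedding functions that agree at `j` satisfy `φ' (j + 1) ≤ φ (j + 1)`. -/
theorem IsEmbed.apply_succ_le {M : PartialMatching P} {γ γ' : FlowPath P} (hγ : γ.Valid M)
    (hγ' : γ'.Valid M) {k k' : ℕ} {φ φ' : ℕ → ℕ} (h : γ.IsEmbed γ' k φ)
    (h' : γ.IsEmbed γ' k' φ') {j : ℕ} (hj : j < k) (hj' : j < k') (heq : φ j = φ' j) :
    φ' (j + 1) ≤ φ (j + 1) := by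
  by_contra! hlt
  have hle := h'.le_of_le (show j + 1 ≤ k' from hj') le_rfl
  obtain ⟨-, hk, hmono, -, hend, hu, -⟩ := h
  obtain ⟨-, -, -, -, hend', -, he'⟩ := h'
  have hjk : j + 1 < k := by
    rcases Nat.lt_or_ge (j + 1) k with hlt' | hge
    · exact hlt'
    · obtain rfl : j + 1 = k := by omega
      omega
  have hpos : φ j < φ (j + 1) := hmono _ _ (Nat.lt_succ_self j) hjk.le
  have hu' := hu (j + 1) (by omega) hjk
  have hle' := he' (j + 1) (φ (j + 1) + 1) (by omega) hj' (by simp only [Nat.add_sub_cancel]; omega)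
    hlt
  obtain ⟨-, -, hlt₂, hne₂⟩ := hγ'.2 (φ (j + 1) - 1) (by omega)
  rw [← hu', Nat.sub_add_cancel (by omega)] at hlt₂ hne₂
  simp only [Nat.add_sub_cancel] at hlt₂ hne₂ hle'
  obtain ⟨hU, hor, -, -⟩ := hγ.2 j (by omega)
  rcases hor with hor | hor
  · exact (lt_of_le_of_lt hle' hlt₂).ne hor
  · exact M.ne_minv_of_le hU hle' hlt₂ hne₂ hor

theorem IsEmbed.apply_eq {M : PartialMatching P} {γ γ' : FlowPath P} (hγ : γ.Valid M)
    (hγ' : γ'.Valid M) {k k' : ℕ} {φ φ' : ℕ → ℕ} (h : γ.IsEmbed γ' k φ)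
    (h' : γ.IsEmbed γ' k' φ') (j : ℕ) (hj : j ≤ k) (hj' : j ≤ k') : φ j = φ' j := by
  induction j with
  | zero => rw [h.2.2.2.1, h'.2.2.2.1]
  | succ j ih =>
    have heq := ih (by omega) (by omega)
    exact le_antisymm (h'.apply_succ_le hγ hγ' h hj' hj heq.symm)
      (h.apply_succ_le hγ hγ' h' hj hj' heq)

theorem IsEmbed.le_length {M : PartialMatching P} {γ γ' : FlowPath P} (hγ : γ.Valid M)
    (hγ' : γ'.Valid M) {k k' : ℕ} {φ φ' : ℕ → ℕ} (h : γ.IsEmbed γ' k φ)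
    (h' : γ.IsEmbed γ' k' φ') : k ≤ k' := by
  by_contra! hlt
  have heq := h.apply_eq hγ hγ' h' k' hlt.le le_rfl
  have hmono := h.2.2.1 k' k hlt le_rfl
  rw [heq, h.2.2.2.2.1, h'.2.2.2.2.1] at hmono
  exact lt_irrefl _ hmono

/-- Embedding functions compose, truncated at the first index whose image is at least `k₂`. -/
theorem IsEmbed.comp {γ₁ γ₂ γ₃ : FlowPath P} {k₁ k₂ k : ℕ} {φ₁ φ₂ : ℕ → ℕ}
    (h₁ : γ₁.IsEmbed γ₂ k₁ φ₁) (h₂ : γ₂.IsEmbed γ₃ k₂ φ₂) (hk : k ≤ k₁) (hk₂ : k₂ ≤ φ₁ k)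
    (hlt : ∀ j < k, φ₁ j < k₂) : γ₁.IsEmbed γ₃ k (fun j => φ₂ (min (φ₁ j) k₂)) := by
  have hmono₂ := @IsEmbed.le_of_le _ _ _ _ _ _ h₂
  obtain ⟨-, hk₁, hm₁, hz₁, -, hu₁, he₁⟩ := h₁
  obtain ⟨hk₂1, -, hm₂, hz₂, hend₂, hu₂, he₂⟩ := h₂
  refine ⟨?_, by omega, ?_, by simp [hz₁, hz₂], by simp [hk₂, hend₂], ?_, ?_⟩
  · by_contra! h0
    obtain rfl : k = 0 := by omega
    omega
  · intro i j hij hjk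
    have := hm₁ i j hij (by omega)
    have := hlt i (by omega)
    exact hm₂ _ _ (by omega) (by omega)
  · intro j hj hjk
    have hjlt := hlt j hjk
    have := hm₁ 0 j (by omega) (by omega)
    simp only [min_eq_left hjlt.le]
    rw [hu₁ j hj (by omega), hu₂ (φ₁ j) (by omega) hjlt]
  · intro j q hj hjk hq hq'
    have hjlt := hlt (j - 1) (by omega)
    simp only [min_eq_left hjlt.le] at hq
    have hex : ∃ p, q ≤ φ₂ p := ⟨_, hq'⟩
    classical
    have hp := Nat.find_spec hex
    have hpmin := Nat.find_min' hex hq'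
    have hpred := @Nat.find_min _ _ hex
    generalize Nat.find hex = p at hp hpmin hpred
    have hgt : φ₁ (j - 1) < p := by
      by_contra! hle
      have := hmono₂ hle hjlt.le
      omega
    exact (he₁ j p hj (by omega) hgt (by omega)).trans
      (he₂ p q (by omega) (by omega) (not_le.1 (hpred (by omega))) hp)

/-- Collapsing along a composite embeds into the concatenation of the collapses. -/
theorem IsEmbed.collapse_subpath {γ₁ γ₂ : FlowPath P} {k₁ k₂ k : ℕ} {φ₁ : ℕ → ℕ}
    (h₁ : γ₁.IsEmbed γ₂ k₁ φ₁) (hk₂1 : 1 ≤ k₂) (hk₂n : k₂ ≤ γ₂.len + 1) (hk1 : 1 ≤ k)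
    (hk : k ≤ k₁) (hk₂ : k₂ ≤ φ₁ k) (hlt : ∀ j < k, φ₁ j < k₂) :
    (γ₁.collapse k).Subpath ((γ₂.collapse k₂).concat (γ₁.collapse k₁)) := by
  have hmono := @IsEmbed.le_of_le _ _ _ _ _ _ h₁
  obtain ⟨-, hk₁, hm₁, hz₁, hend₁, hu₁, he₁⟩ := h₁
  have hl₁ := γ₁.len_collapse k
  have hl₁' := γ₁.len_collapse k₁
  have hl₂ := γ₂.len_collapse k₂
  let ψ : ℕ → ℕ := fun j => if k - 1 + j ≤ k₁ then φ₁ (k - 1 + j) - (k₂ - 1)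
    else γ₂.len + 1 - (k₂ - 1) + (k - 1 + j - k₁)
  have hψ_le : ∀ j, k - 1 + j ≤ k₁ → ψ j = φ₁ (k - 1 + j) - (k₂ - 1) := fun j hj => if_pos hj
  have hψ_ge : ∀ j, k₁ ≤ k - 1 + j →
      ψ j = γ₂.len + 1 - (k₂ - 1) + (k - 1 + j - k₁) := by
    intro j hj
    rcases hj.eq_or_lt with heq | hlt'
    · rw [hψ_le j heq.ge, ← heq, hend₁]
      omega
    · exact if_neg (by omega)
  refine ⟨γ₁.len + 2 - k, ψ, by omega, by omega, ?_, ?_, ?_, ?_, ?_⟩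
  · intro i j hij hj
    rcases le_or_gt (k - 1 + j) k₁ with hj' | hj'
    · rw [hψ_le i (by omega), hψ_le j hj']
      have := hm₁ (k - 1 + i) (k - 1 + j) (by omega) hj'
      have := hmono (show k ≤ k - 1 + j by omega) hj'
      omega
    · rw [hψ_ge j hj'.le]
      rcases le_or_gt (k - 1 + i) k₁ with hi' | hi'
      · rw [hψ_le i hi']
        have := hmono hi' le_rfl
        omega
      · rw [hψ_ge i hi'.le]
        omega
  · rw [hψ_le 0 (by omega)]
    have := hlt (k - 1) (by omega)
    simp only [Nat.add_zero]
    omega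
  · rw [hψ_ge _ (by omega), len_concat]
    omega
  · intro j hj hjk
    rw [uAt_collapse]
    rcases lt_or_ge (k - 1 + j) k₁ with hj' | hj'
    · have hlt' := hm₁ (k - 1 + j) k₁ hj' le_rfl
      have hge := hmono (show k ≤ k - 1 + j by omega) hj'.le
      rw [hψ_le j hj'.le, uAt_concat_left _ _ (by omega), uAt_collapse]
      convert hu₁ (k - 1 + j) (by omega) hj' using 2 <;> omega
    · rw [hψ_ge j hj', uAt_concat_right _ _ (by omega), uAt_collapse]
      exact congrArg _ (by omega)
  · intro j p hj hjk hp hp'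
    rw [eAt_collapse]
    rcases lt_or_ge (p - 1) (γ₂.collapse k₂).len with hpl | hpl
    · rw [eAt_concat_left _ _ hpl, eAt_collapse]
      have hj' : k - 1 + j ≤ k₁ := by
        by_contra! hgt
        rw [hψ_ge (j - 1) (by omega)] at hp
        omega
      rw [hψ_le _ (by omega)] at hp hp'
      have hadd : k - 1 + (j - 1) = k - 1 + j - 1 := by omega
      have hlow : φ₁ (k - 1 + j - 1) < k₂ - 1 + p := by
        rw [hadd] at hp
        omega
      have := he₁ (k - 1 + j) (k₂ - 1 + p) (by omega) hj' hlow (by omega)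
      convert this using 2; omega
    · have hj' : k₁ ≤ k - 1 + j := by
        by_contra! hgt
        rw [hψ_le j hgt.le] at hp'
        have := hm₁ (k - 1 + j) k₁ hgt le_rfl
        omega
      rw [eAt_concat_right _ _ hpl, eAt_collapse]
      have hpj : p = ψ j := by
        rcases hj'.eq_or_lt with heq | hlt'
        · rw [hψ_ge j hj'] at hp' ⊢
          omega
        · rw [hψ_ge j hj'] at hp' ⊢
          rw [hψ_ge (j - 1) (by omega)] at hp
          omega
      rw [hψ_ge j hj'] at hpj
      exact le_of_eq (congrArg _ (by omega))

end FlowPath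

/-- colax functoriality of the collapse: for `γ₁ ⪯ γ₂ ⪯ γ₃`, the
concatenation of `τ(γ₂ ⪯ γ₃)` with `τ(γ₁ ⪯ γ₂)` (with target `τ(γ₁)`) is a flow path
and `τ(γ₁ ⪯ γ₃) ⪯` this flow path.  Here the collapses are expressed via the (unique)
embedding functions: `τ(γ ⪯ γ') = γ.collapse k` where `φ : {0,…,k} → {0,…,ℓ(γ')+1}`
is the embedding function for `γ ⪯ γ'`. -/
theorem stmt16 {P : Type} [PartialOrder P] [Fintype P]
    (rk : P → ℕ) (hrk : ∀ a b : P, a ⋖ b → rk b = rk a + 1)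
    (M : PartialMatching P) (hM : M.IsAcyclic)
    (γ₁ γ₂ γ₃ : FlowPath P)
    (h₁ : γ₁.Valid M) (h₂ : γ₂.Valid M) (h₃ : γ₃.Valid M)
    (k₁ k₂ k₃ : ℕ) (φ₁ φ₂ φ₃ : ℕ → ℕ)
    (he₁ : γ₁.IsEmbed γ₂ k₁ φ₁) (he₂ : γ₂.IsEmbed γ₃ k₂ φ₂) (he₃ : γ₁.IsEmbed γ₃ k₃ φ₃) :
    ((γ₂.collapse k₂).concat (γ₁.collapse k₁)).Valid M ∧
    (γ₁.collapse k₃).Subpath ((γ₂.collapse k₂).concat (γ₁.collapse k₁)) := by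
  obtain ⟨hk₁1, hk₁n, -, -, hend₁, -, hle₁⟩ := id he₁
  obtain ⟨hk₂1, hk₂n, -, -, -, -, -⟩ := id he₂
  constructor
  · refine (h₂.collapse k₂).concat (h₁.collapse k₁) ?_
    have hpred := he₁.2.2.1 (k₁ - 1) k₁ (by omega) le_rfl
    have hle := hle₁ k₁ (γ₂.len + 1) hk₁1 le_rfl (by omega) hend₁.ge
    rw [Nat.add_sub_cancel, FlowPath.eAt_len] at hle
    rw [FlowPath.init, FlowPath.eAt_collapse]
    exact hle
  · have hex : ∃ j, k₂ ≤ φ₁ j := ⟨k₁, by omega⟩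
    classical
    have hk := Nat.find_min' hex (show k₂ ≤ φ₁ k₁ by omega)
    have hspec := Nat.find_spec hex
    have hmin : ∀ j < Nat.find hex, φ₁ j < k₂ := fun j hj => not_le.1 (Nat.find_min hex hj)
    have hcomp := he₁.comp he₂ hk hspec hmin
    rw [le_antisymm (he₃.le_length h₁ h₃ hcomp) (hcomp.le_length h₁ h₃ he₃)]
    exact he₁.collapse_subpath hk₂1 hk₂n hcomp.1 hk hspec hmin
end

section
/- Let μ be an acyclic partial matching on a finite graded poset P, f a faithful discrete Morse function adapted to μ, c a critical element, d ∈ D, and ℓ = f(d). Let F_ℓ = {γ ∈ FP(μ) : τ(γ) = c and f(ι(γ)) ≤ ℓ} and F_{ℓ−1} = {γ ∈ FP(μ) : τ(γ) = c and f(ι(γ)) ≤ ℓ−1}, regarded as subposets of (FP(μ), ⪯). Define m : F_ℓ → FP(μ) by m(γ) = (μ(d), μ(d), e₂, u₂, …, e_n, u_n; c) if γ = (d, μ(d), e₂, u₂, …, e_n, u_n; c) has initial cell d, and m(γ) = γ otherwise. Then m maps F_ℓ into F_ℓ, is idempotent, satisfies γ ⪯ m(γ) for all γ ∈ F_ℓ,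 is monotone (γ ⪯ γ' implies m(γ) ⪯ m(γ')), and its image is exactly F_{ℓ−1}; that is, m is an ascending closure operator on F_ℓ with image F_{ℓ−1}. -/
/-- The operator `m` of STATEMENT 18: if `ι(γ) = d`, replace the first pair
`(d, μ d)` of `γ` by `(μ d, μ d)`; otherwise leave `γ` unchanged. -/
def mOp {P : Type} [PartialOrder P] [DecidableEq P] (M : PartialMatching P) (d : P)
    (γ : FlowPath P) : FlowPath P :=
  if γ.init = d then ⟨γ.steps.modifyHead (fun _ => (M.m d, M.m d)), γ.c⟩ else γ

section FlowPathOperator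

variable {P : Type} [PartialOrder P] {M : PartialMatching P} {γ : FlowPath P} {d : P}

/-- A valid flow path starting in `D` has positive length and starts with the pair
`(d, M.m d)`. -/
theorem FlowPath.Valid.steps_eq_of_init_mem_D (h : γ.Valid M) (hd : γ.init ∈ M.D) :
    ∃ t, γ.steps = (γ.init, M.m γ.init) :: t := by
  obtain ⟨steps, c⟩ := γ
  obtain ⟨hc, hs⟩ := h
  cases steps with
  | nil => exact absurd (Or.inl hd) hc
  | cons a t =>
    obtain ⟨hu, he, -⟩ := hs 0 (by simp [FlowPath.len])
    obtain ⟨e, u⟩ := a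
    simp only [FlowPath.eAt, FlowPath.uAt, FlowPath.init, List.map_cons,
      List.getD_cons_zero] at hu he hd ⊢
    rcases he with rfl | rfl
    · exact absurd hu (Set.disjoint_left.mp M.disj hd)
    · exact ⟨t, by rw [M.right_inv u hu]⟩

/-- A valid flow path starting in `U` has positive length and its first pair is
`(u, u)`. -/
theorem FlowPath.Valid.uAt_zero_of_init_mem_U (h : γ.Valid M) (hu : γ.init ∈ M.U) :
    0 < γ.len ∧ γ.uAt 0 = γ.init := by
  have hlen : 0 < γ.len := by
    obtain ⟨steps, c⟩ := γ
    cases steps with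
    | nil => exact absurd (Or.inr hu) h.1
    | cons a t => simp [FlowPath.len]
  obtain ⟨hU, he, -⟩ := h.2 0 hlen
  refine ⟨hlen, ?_⟩
  rcases he with he | he
  · exact he.symm
  · have hD : γ.init ∈ M.D := by
      rw [FlowPath.init, he]
      exact M.minv_mem _ hU
    exact absurd hu (Set.disjoint_left.mp M.disj hD)

/-- No cell strictly below `M.m d` other than `d` lies above `d`, so if the first upper
cell of a valid flow path is `M.m d`, then the second cell is not above `d`. -/
theorem FlowPath.Valid.not_le_eAt_one (h : γ.Valid M) (hd : d ∈ M.D) (hlen : 0 < γ.len)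
    (hu : γ.uAt 0 = M.m d) : ¬ d ≤ γ.eAt 1 := by
  intro hle
  obtain ⟨-, -, hlt, hne⟩ := h.2 0 hlen
  rw [hu] at hlt hne
  rw [M.left_inv d hd] at hne
  exact (M.cov d hd).2 (lt_of_le_of_ne hle hne.symm) hlt

theorem FlowPath.Valid.uAt_zero_of_init_eq (h : γ.Valid M) (hd : d ∈ M.D)
    (hi : γ.init = d) : 0 < γ.len ∧ γ.uAt 0 = M.m d := by
  obtain ⟨t, ht⟩ := h.steps_eq_of_init_mem_D (hi ▸ hd)
  simp [FlowPath.len, FlowPath.uAt, ht, hi]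

variable [DecidableEq P]

theorem mOp_of_init_ne (h : γ.init ≠ d) : mOp M d γ = γ := if_neg h

theorem mOp_c : (mOp M d γ).c = γ.c := by
  unfold mOp
  split_ifs <;> rfl

theorem mOp_len : (mOp M d γ).len = γ.len := by
  unfold mOp FlowPath.len
  split_ifs <;> simp

theorem FlowPath.Valid.init_mOp (h : γ.Valid M) (hd : d ∈ M.D) (hi : γ.init = d) :
    (mOp M d γ).init = M.m d := by
  obtain ⟨t, ht⟩ := h.steps_eq_of_init_mem_D (hi ▸ hd)
  rw [mOp, if_pos hi, ht]
  simp [FlowPath.init, FlowPath.eAt]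

theorem FlowPath.Valid.eAt_mOp_succ (h : γ.Valid M) (hd : d ∈ M.D) (i : ℕ) :
    (mOp M d γ).eAt (i + 1) = γ.eAt (i + 1) := by
  by_cases hi : γ.init = d
  · obtain ⟨t, ht⟩ := h.steps_eq_of_init_mem_D (hi ▸ hd)
    rw [mOp, if_pos hi]
    simp [FlowPath.eAt, ht]
  · rw [mOp_of_init_ne hi]

theorem FlowPath.Valid.uAt_mOp (h : γ.Valid M) (hd : d ∈ M.D) (i : ℕ) :
    (mOp M d γ).uAt i = γ.uAt i := by
  by_cases hi : γ.init = d
  · obtain ⟨t, ht⟩ := h.steps_eq_of_init_mem_D (hi ▸ hd)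
    rw [mOp, if_pos hi]
    simp [FlowPath.uAt, ht, hi]
  · rw [mOp_of_init_ne hi]

theorem FlowPath.Valid.eAt_le_eAt_mOp (h : γ.Valid M) (hd : d ∈ M.D) (i : ℕ) :
    γ.eAt i ≤ (mOp M d γ).eAt i := by
  cases i with
  | zero =>
    by_cases hi : γ.init = d
    · exact hi.le.trans ((M.cov d hd).le.trans (h.init_mOp hd hi).ge)
    · rw [mOp_of_init_ne hi]
  | succ i => exact (h.eAt_mOp_succ hd i).ge

theorem FlowPath.Valid.mOp (h : γ.Valid M) (hd : d ∈ M.D) : (mOp M d γ).Valid M := by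
  refine ⟨mOp_c (M := M) (d := d) (γ := γ) ▸ h.1, fun i hi => ?_⟩
  rw [mOp_len] at hi
  obtain ⟨h1, h2, h3⟩ := h.2 i hi
  rw [h.uAt_mOp hd, h.eAt_mOp_succ hd]
  refine ⟨h1, ?_, h3⟩
  cases i with
  | zero =>
    by_cases hi : γ.init = d
    · exact Or.inl ((h.init_mOp hd hi).trans (h.uAt_zero_of_init_eq hd hi).2.symm)
    · rwa [mOp_of_init_ne hi]
  | succ i => rwa [h.eAt_mOp_succ hd]

theorem FlowPath.Valid.subpath_mOp (h : γ.Valid M) (hd : d ∈ M.D) :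
    γ.Subpath (_root_.mOp M d γ) := by
  refine ⟨γ.len + 1, id, by omega, le_rfl, fun i j hij _ => hij, rfl, by simp [mOp_len],
    fun j _ _ => (h.uAt_mOp hd _).symm, fun j p h1 _ h3 h4 => ?_⟩
  simp only [id] at h3 h4
  obtain rfl : p = j := by omega
  exact h.eAt_le_eAt_mOp hd _

theorem FlowPath.Valid.f_init_mOp_lt {f : P → ℤ} (hf : M.Faithful f) (h : γ.Valid M)
    (hd : d ∈ M.D) (hle : f γ.init ≤ f d) : f (_root_.mOp M d γ).init < f d := by
  by_cases hi : γ.init = d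
  · rw [h.init_mOp hd hi]
    exact hf.2.1 d hd
  · rw [mOp_of_init_ne hi]
    exact lt_of_le_of_ne hle fun he => hi (hf.1 he)

theorem FlowPath.Valid.mOp_mOp (h : γ.Valid M) (hd : d ∈ M.D) :
    _root_.mOp M d (_root_.mOp M d γ) = _root_.mOp M d γ := by
  by_cases hi : γ.init = d
  · apply mOp_of_init_ne
    rw [h.init_mOp hd hi]
    exact (M.cov d hd).lt.ne'
  · rw [mOp_of_init_ne hi, mOp_of_init_ne hi]

theorem FlowPath.Subpath.mOp {γ' : FlowPath P} {f : P → ℤ} (hf : M.Faithful f)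
    (hd : d ∈ M.D) (h : γ.Valid M) (h' : γ'.Valid M) (hle : f γ'.init ≤ f d)
    (hs : γ.Subpath γ') : (mOp M d γ).Subpath (_root_.mOp M d γ') := by
  obtain ⟨k, φ, hk1, hk, hmono, h0, hlast, hu, he⟩ := hs
  refine ⟨k, φ, hk1, by rwa [mOp_len], hmono, h0, by rwa [mOp_len],
    fun j h1 h2 => by rw [h.uAt_mOp hd, h'.uAt_mOp hd, hu j h1 h2], fun j p h1 h2 h3 h4 => ?_⟩
  by_cases hi : γ.init = d ∧ j = 1
  · obtain ⟨hi, rfl⟩ := hi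
    have hle1 : d ≤ γ'.init := by
      have := he 1 1 le_rfl hk1 (by simp [h0]) (by omega)
      rw [← hi]
      exact this
    have hu' : (0 < γ'.len ∧ γ'.uAt 0 = M.m d) ∧ (_root_.mOp M d γ').init = M.m d := by
      by_cases hi' : γ'.init = d
      · exact ⟨h'.uAt_zero_of_init_eq hd hi', h'.init_mOp hd hi'⟩
      · have hm : γ'.init = M.m d := by
          by_contra hne
          exact absurd (hf.2.2 _ _ (lt_of_le_of_ne hle1 (Ne.symm hi')) fun hh => hne hh.2)
            hle.not_gt
        rw [mOp_of_init_ne hi']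
        exact ⟨hm ▸ h'.uAt_zero_of_init_mem_U (hm ▸ M.m_mem d hd), hm⟩
    obtain ⟨⟨hlen, hu0⟩, hinit⟩ := hu'
    have hφ : φ 1 < 2 := by
      by_contra hφ
      refine h'.not_le_eAt_one hd hlen hu0 ?_
      have := he 1 2 le_rfl hk1 (by simp [h0]) (by omega)
      rw [← hi]
      exact this
    simp only [Nat.sub_self, h0] at h3
    obtain rfl : p = 1 := by omega
    exact ((h.init_mOp hd hi).trans hinit.symm).le
  · have hγ : (_root_.mOp M d γ).eAt (j - 1) = γ.eAt (j - 1) := by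
      by_cases hd' : γ.init = d
      · have hj : j ≠ 1 := fun hj => hi ⟨hd', hj⟩
        obtain ⟨i, rfl⟩ : ∃ i, j = i + 2 := ⟨j - 2, by omega⟩
        exact h.eAt_mOp_succ hd i
      · rw [mOp_of_init_ne hd']
    rw [hγ]
    exact (he j p h1 h2 h3 h4).trans (h'.eAt_le_eAt_mOp hd _)

end FlowPathOperator

/-- with `ℓ = f d`, the operator `m` is an ascending closure operator
on `F_ℓ = {γ : τ(γ) = c, f(ι(γ)) ≤ ℓ}` whose image is exactly `F_{ℓ-1}`. -/
theorem stmt18 {P : Type} [PartialOrder P] [Fintype P] [DecidableEq P]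
    (rk : P → ℕ) (hrk : ∀ a b : P, a ⋖ b → rk b = rk a + 1)
    (M : PartialMatching P) (hM : M.IsAcyclic)
    (f : P → ℤ) (hf : M.Faithful f)
    (c : P) (hc : c ∈ M.Cr) (d : P) (hd : d ∈ M.D)
    (Fl Flm : FlowPath P → Prop)
    (hFl : ∀ γ, Fl γ ↔ γ.Valid M ∧ γ.tgt = c ∧ f γ.init ≤ f d)
    (hFlm : ∀ γ, Flm γ ↔ γ.Valid M ∧ γ.tgt = c ∧ f γ.init ≤ f d - 1) :
    (∀ γ, Fl γ → Fl (mOp M d γ)) ∧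
    (∀ γ, Fl γ → mOp M d (mOp M d γ) = mOp M d γ) ∧
    (∀ γ, Fl γ → γ.Subpath (mOp M d γ)) ∧
    (∀ γ γ', Fl γ → Fl γ' → γ.Subpath γ' → (mOp M d γ).Subpath (mOp M d γ')) ∧
    (∀ γ, Fl γ → Flm (mOp M d γ)) ∧
    (∀ δ, Flm δ → ∃ γ, Fl γ ∧ mOp M d γ = δ) := by
 
  refine ⟨fun γ h => ?_, fun γ h => ?_, fun γ h => ?_, fun γ γ' h h' hs => ?_,
    fun γ h => ?_, fun δ h => ?_⟩
  · obtain ⟨hv, ht, hle⟩ := (hFl γ).1 h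
    exact (hFl _).2 ⟨hv.mOp hd, mOp_c.trans ht, (hv.f_init_mOp_lt hf hd hle).le⟩
  · exact ((hFl γ).1 h).1.mOp_mOp hd
  · exact ((hFl γ).1 h).1.subpath_mOp hd
  · obtain ⟨hv', -, hle'⟩ := (hFl γ').1 h'
    exact hs.mOp hf hd ((hFl γ).1 h).1 hv' hle'
  · obtain ⟨hv, ht, hle⟩ := (hFl γ).1 h
    exact (hFlm _).2 ⟨hv.mOp hd, mOp_c.trans ht,
      Int.le_sub_one_of_lt (hv.f_init_mOp_lt hf hd hle)⟩
  · obtain ⟨hv, ht, hle⟩ := (hFlm δ).1 h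
    refine ⟨δ, (hFl δ).2 ⟨hv, ht, by omega⟩, mOp_of_init_ne fun hi => ?_⟩
    rw [hi] at hle
    omega
end

section
/- Let μ be an acyclic partial matching on a finite graded poset P, f a faithful discrete Morse function adapted to μ, c a critical element, u ∈ U, and ℓ = f(u). Let F_ℓ = {γ ∈ FP(μ) : τ(γ) = c and f(ι(γ)) ≤ ℓ} and F_{ℓ−1} = {γ ∈ FP(μ) : τ(γ) = c and f(ι(γ)) ≤ ℓ−1}, regarded as subposets of (FP(μ), ⪯). Define b : F_ℓ → FP(μ) by b(γ) = (e₂, u₂, …, e_n, u_n; c) if γ = (e₁, u₁, …, e_n, u_n; c) has initial cell e₁ = u (in which case necessarily n ≥ 1 and u₁ = u), and b(γ) = γ otherwise. Then b maps F_ℓ into F_ℓ, is idempotent, satisfies b(γ) ⪯ γ for all γ ∈ F_ℓ, is monotone (γ ⪯ γ' implies b(γ) ⪯ b(γ')), and its image is exactly F_{ℓ−1}; that is, b is a descending closure operator on F_ℓ with image F_{ℓ−1}. -/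
/-- The operator `b` of STATEMENT 19: if `ι(γ) = u` (so that the first pair of `γ`
is `(u, u)`), delete the first pair of `γ`; otherwise leave `γ` unchanged. -/
def bOp {P : Type} [DecidableEq P] (u : P) (γ : FlowPath P) : FlowPath P :=
  if γ.init = u then ⟨γ.steps.tail, γ.c⟩ else γ

namespace FlowPath

variable {P : Type}

/-- The flow path obtained by deleting the first pair. -/
def tail (γ : FlowPath P) : FlowPath P := ⟨γ.steps.tail, γ.c⟩

theorem eAt_tail (γ : FlowPath P) (i : ℕ) : γ.tail.eAt i = γ.eAt (i + 1) := by
  obtain ⟨_ | ⟨_, _⟩, _⟩ := γ <;> simp [tail, eAt]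

theorem uAt_tail (γ : FlowPath P) (i : ℕ) : γ.tail.uAt i = γ.uAt (i + 1) := by
  obtain ⟨_ | ⟨_, _⟩, _⟩ := γ <;> simp [tail, uAt]

theorem len_tail (γ : FlowPath P) : γ.tail.len = γ.len - 1 := by
  simp [tail, len]

theorem init_eq_c_of_len_eq_zero {γ : FlowPath P} (h : γ.len = 0) : γ.init = γ.c := by
  obtain ⟨_ | ⟨_, _⟩, _⟩ := γ <;> simp_all [init, eAt, len]

variable [PartialOrder P] {M : PartialMatching P} {γ γ' : FlowPath P} {u : P}

theorem Valid.tail (h : γ.Valid M) : γ.tail.Valid M := by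
  refine ⟨h.1, fun i hi => ?_⟩
  rw [len_tail] at hi
  simpa only [eAt_tail, uAt_tail] using h.2 (i + 1) (by omega)

theorem Valid.len_pos_of_init_mem (h : γ.Valid M) (hu : γ.init ∈ M.U) : 0 < γ.len := by
  by_contra hlen
  rw [init_eq_c_of_len_eq_zero (by omega)] at hu
  exact h.1 (Or.inr hu)

theorem Valid.uAt_zero_of_init_mem (h : γ.Valid M) (hu : γ.init ∈ M.U) :
    γ.uAt 0 = γ.init := by
  obtain ⟨hU, he | he, -⟩ := h.2 0 (h.len_pos_of_init_mem hu)
  · exact he.symm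
  · exact absurd hu (Set.disjoint_left.mp M.disj (by
      rw [init, he]; exact M.minv_mem _ hU))

theorem Valid.eAt_one_lt_init (h : γ.Valid M) (hu : γ.init ∈ M.U) :
    γ.eAt 1 < γ.init := by
  rw [← h.uAt_zero_of_init_mem hu]
  exact (h.2 0 (h.len_pos_of_init_mem hu)).2.2.1

/-- Deleting a first pair `(u, u)` strictly lowers the value of the initial cell. -/
theorem Valid.init_tail_lt {f : P → ℤ} (hf : M.Faithful f) (h : γ.Valid M)
    (hu : γ.init ∈ M.U) : f γ.tail.init < f γ.init := by
  have hne := (h.2 0 (h.len_pos_of_init_mem hu)).2.2.2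
  rw [h.uAt_zero_of_init_mem hu] at hne
  rw [init, eAt_tail]
  refine hf.2.2 _ _ (h.eAt_one_lt_init hu) fun ⟨hD, he⟩ => hne ?_
  rw [he, M.left_inv _ hD]

theorem Subpath.init_le (h : γ.Subpath γ') : γ.init ≤ γ'.init := by
  obtain ⟨k, φ, hk, -, hmono, h0, -, -, hle⟩ := h
  have := hmono 0 1 one_pos hk
  exact hle 1 1 le_rfl hk (by simp [h0]) (by omega)

theorem Subpath.refl (γ : FlowPath P) : γ.Subpath γ := by
  refine ⟨γ.len + 1, id, by omega, le_rfl, fun i j h _ => h, rfl, rfl, fun _ _ _ => rfl, ?_⟩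
  intro j p h1 _ h2 h3
  obtain rfl : j = p := by simp only [id] at h2 h3; omega
  exact le_rfl

theorem Valid.tail_subpath (h : γ.Valid M) (hu : γ.init ∈ M.U) : γ.tail.Subpath γ := by
  have hlen := h.len_pos_of_init_mem hu
  refine ⟨γ.len, fun j => if j = 0 then 0 else j + 1, hlen, by rw [len_tail]; omega,
    fun i j hij _ => by dsimp only; split_ifs <;> omega, rfl, if_neg hlen.ne', ?_, ?_⟩
  · intro j h1 _
    rw [uAt_tail]
    dsimp only
    rw [if_neg (by omega)]
    congr 1
    omega
  · intro j p h1 _ h2 h3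
    rw [eAt_tail]
    dsimp only at h2 h3
    rw [if_neg (by omega)] at h3
    obtain rfl | ⟨rfl, rfl⟩ : p = j + 1 ∨ (p = 1 ∧ j = 1) := by split_ifs at h2 <;> omega
    · exact le_of_eq (by congr 1; omega)
    · exact (h.eAt_one_lt_init hu).le

/-- An embedding into `γ'` whose first value is at least `2` restricts to the tail of `γ'`. -/
theorem IsEmbed.tail_right {k : ℕ} {φ : ℕ → ℕ} (h : γ.IsEmbed γ' k φ)
    (hlen : 0 < γ'.len) (h2 : 2 ≤ φ 1) : γ.IsEmbed γ'.tail k (fun j => φ j - 1) := by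
  obtain ⟨hk, hkl, hmono, h0, hφk, hu, he⟩ := h
  have hpos : ∀ j, 1 ≤ j → j ≤ k → 2 ≤ φ j := fun j h1 hj => by
    rcases h1.eq_or_lt with rfl | h1
    · exact h2
    · have := hmono 1 j h1 hj
      omega
  refine ⟨hk, hkl, fun i j hij hj => ?_, by simp [h0], by
    dsimp only; rw [len_tail, hφk]; omega, ?_, ?_⟩
  · have := hmono i j hij hj
    have := hpos j (by omega) hj
    dsimp only
    omega
  · intro j h1 hj
    have := hpos j h1 hj.le
    rw [hu j h1 hj, uAt_tail]
    dsimp only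
    congr 1
    omega
  · intro j p h1 hj hp hp'
    dsimp only at hp hp'
    have := he j (p + 1) h1 hj (by omega) (by have := hpos j h1 hj; omega)
    rw [eAt_tail]
    rwa [show p - 1 + 1 = p + 1 - 1 by omega]

/-- An embedding whose first value is `1` restricts to the tails. -/
theorem IsEmbed.tail_tail {k : ℕ} {φ : ℕ → ℕ} (h : γ.IsEmbed γ' k φ)
    (hlen : 0 < γ.len) (hlen' : 0 < γ'.len) (h1 : φ 1 = 1) :
    γ.tail.IsEmbed γ'.tail (k - 1) (fun j => φ (j + 1) - 1) := by
  obtain ⟨hk, hkl, hmono, h0, hφk, hu, he⟩ := h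
  have hk2 : 2 ≤ k := by
    by_contra hk2
    obtain rfl : k = 1 := by omega
    omega
  have hpos : ∀ j, 1 ≤ j → j < k → 2 ≤ φ (j + 1) := fun j hj hjk => by
    have := hmono 1 (j + 1) (by omega) (by omega)
    omega
  refine ⟨by omega, by rw [len_tail]; omega, fun i j hij hj => ?_, by simp [h1], ?_, ?_, ?_⟩
  · have := hmono (i + 1) (j + 1) (by omega) (by omega)
    have := hpos j (by omega) (by omega)
    have : 0 < φ (i + 1) := by
      have := hmono 0 (i + 1) (by omega) (by omega)
      omega
    dsimp only
    omega
  · dsimp only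
    rw [len_tail, Nat.sub_add_cancel hk, hφk]
    omega
  · intro j hj hjk
    have := hpos j hj (by omega)
    have := hu (j + 1) (by omega) (by omega)
    rw [uAt_tail, uAt_tail]
    rwa [show j - 1 + 1 = j + 1 - 1 by omega,
      show φ (j + 1) - 1 - 1 + 1 = φ (j + 1) - 1 by omega]
  · intro j p hj hjk hp hp'
    dsimp only at hp hp'
    rw [Nat.sub_add_cancel hj] at hp
    have := hpos j hj (by omega)
    have := he (j + 1) (p + 1) (by omega) (by omega)
      (by rw [Nat.add_sub_cancel]; omega) (by omega)
    rw [eAt_tail, eAt_tail]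
    rwa [show j - 1 + 1 = j + 1 - 1 by omega, show p - 1 + 1 = p + 1 - 1 by omega]

end FlowPath

section BOp

open FlowPath

variable {P : Type} [DecidableEq P] {γ γ' : FlowPath P} {u : P}

theorem bOp_of_init_eq (h : γ.init = u) : bOp u γ = γ.tail := if_pos h

theorem bOp_of_init_ne (h : γ.init ≠ u) : bOp u γ = γ := if_neg h

theorem tgt_bOp (u : P) (γ : FlowPath P) : (bOp u γ).tgt = γ.tgt := by
  unfold bOp
  split_ifs <;> rfl

variable [PartialOrder P] {M : PartialMatching P} {f : P → ℤ}

theorem bOp_valid (h : γ.Valid M) : (bOp u γ).Valid M := by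
  by_cases hi : γ.init = u
  · rw [bOp_of_init_eq hi]
    exact h.tail
  · rwa [bOp_of_init_ne hi]

theorem init_bOp_lt (hf : M.Faithful f) (hu : u ∈ M.U) (h : γ.Valid M)
    (hle : f γ.init ≤ f u) : f (bOp u γ).init < f u := by
  by_cases hi : γ.init = u
  · subst hi
    rw [bOp_of_init_eq rfl]
    exact h.init_tail_lt hf hu
  · rw [bOp_of_init_ne hi]
    exact lt_of_le_of_ne hle fun he => hi (hf.1 he)

theorem bOp_subpath (hu : u ∈ M.U) (h : γ.Valid M) : (bOp u γ).Subpath γ := by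
  by_cases hi : γ.init = u
  · rw [bOp_of_init_eq hi]
    exact h.tail_subpath (hi ▸ hu)
  · rw [bOp_of_init_ne hi]
    exact Subpath.refl γ

theorem bOp_subpath_bOp (hf : M.Faithful f) (hu : u ∈ M.U) (h : γ.Valid M) (h' : γ'.Valid M)
    (hle : f γ.init ≤ f u) (hle' : f γ'.init ≤ f u) (hs : γ.Subpath γ') :
    (bOp u γ).Subpath (bOp u γ') := by
  by_cases hi' : γ'.init = u
  · have hlen' := h'.len_pos_of_init_mem (hi' ▸ hu)
    rw [bOp_of_init_eq hi']
    obtain ⟨k, φ, hφ⟩ := hs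
    obtain ⟨hk, hkl, hmono, h0, hφk, hu', he⟩ := id hφ
    have h01 := hmono 0 1 one_pos hk
    by_cases hi : γ.init = u
    · have hlen := h.len_pos_of_init_mem (hi ▸ hu)
      rw [bOp_of_init_eq hi]
      refine ⟨_, _, hφ.tail_tail hlen hlen' ?_⟩
      by_contra h1
      have hue : γ.init ≤ γ'.eAt 1 := he 1 2 le_rfl hk (by simp [h0]) (by omega)
      have hlt := h'.eAt_one_lt_init (hi' ▸ hu)
      rw [hi'] at hlt
      rw [hi] at hue
      exact absurd hlt hue.not_gt
    · rw [bOp_of_init_ne hi]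
      refine ⟨_, _, hφ.tail_right hlen' ?_⟩
      by_contra h2
      have h1 : φ 1 = 1 := by omega
      have hk2 : 1 < k := by
        by_contra hk2
        obtain rfl : k = 1 := by omega
        omega
      have hu0 : γ.uAt 0 = u := by
        have := hu' 1 le_rfl hk2
        rw [h1] at this
        rw [← hi', ← h'.uAt_zero_of_init_mem (hi' ▸ hu)]
        exact this
      obtain ⟨-, hor, -⟩ := h.2 0 (by omega)
      rw [hu0] at hor
      have hlt := hf.2.1 _ (M.minv_mem u hu)
      rw [M.right_inv u hu, ← hor.resolve_left hi] at hlt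
      exact absurd hle hlt.not_ge
  · by_cases hi : γ.init = u
    · have hlt : u < γ'.init := lt_of_le_of_ne (hi ▸ hs.init_le) (Ne.symm hi')
      have := hf.2.2 _ _ hlt fun ⟨hD, _⟩ => Set.disjoint_left.mp M.disj hD hu
      omega
    · rwa [bOp_of_init_ne hi, bOp_of_init_ne hi']

end BOp

/-- with `ℓ = f u`, the operator `b` is a descending closure operator
on `F_ℓ = {γ : τ(γ) = c, f(ι(γ)) ≤ ℓ}` whose image is exactly `F_{ℓ-1}`. -/
theorem stmt19 {P : Type} [PartialOrder P] [Fintype P] [DecidableEq P]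
    (rk : P → ℕ) (hrk : ∀ a b : P, a ⋖ b → rk b = rk a + 1)
    (M : PartialMatching P) (hM : M.IsAcyclic)
    (f : P → ℤ) (hf : M.Faithful f)
    (c : P) (hc : c ∈ M.Cr) (u : P) (hu : u ∈ M.U)
    (Fl Flm : FlowPath P → Prop)
    (hFl : ∀ γ, Fl γ ↔ γ.Valid M ∧ γ.tgt = c ∧ f γ.init ≤ f u)
    (hFlm : ∀ γ, Flm γ ↔ γ.Valid M ∧ γ.tgt = c ∧ f γ.init ≤ f u - 1) :
    (∀ γ, Fl γ → Fl (bOp u γ)) ∧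
    (∀ γ, Fl γ → bOp u (bOp u γ) = bOp u γ) ∧
    (∀ γ, Fl γ → (bOp u γ).Subpath γ) ∧
    (∀ γ γ', Fl γ → Fl γ' → γ.Subpath γ' → (bOp u γ).Subpath (bOp u γ')) ∧
    (∀ γ, Fl γ → Flm (bOp u γ)) ∧
    (∀ δ, Flm δ → ∃ γ, Fl γ ∧ bOp u γ = δ) := by
  simp only [hFl, hFlm]
  have hne : ∀ γ : FlowPath P, f γ.init < f u → γ.init ≠ u := fun γ h he => by
    rw [he] at h
    exact h.false
  refine ⟨?_, ?_, ?_, ?_, ?_, ?_⟩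
  · rintro γ ⟨hv, ht, hle⟩
    exact ⟨bOp_valid hv, (tgt_bOp u γ).trans ht, (init_bOp_lt hf hu hv hle).le⟩
  · rintro γ ⟨hv, -, hle⟩
    exact bOp_of_init_ne (hne _ (init_bOp_lt hf hu hv hle))
  · rintro γ ⟨hv, -, -⟩
    exact bOp_subpath hu hv
  · rintro γ γ' ⟨hv, -, hle⟩ ⟨hv', -, hle'⟩ hs
    exact bOp_subpath_bOp hf hu hv hv' hle hle' hs
  · rintro γ ⟨hv, ht, hle⟩
    exact ⟨bOp_valid hv, (tgt_bOp u γ).trans ht, Int.le_sub_one_of_lt (init_bOp_lt hf hu hv hle)⟩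
  · rintro δ ⟨hv, ht, hle⟩
    exact ⟨δ, ⟨hv, ht, by omega⟩, bOp_of_init_ne (hne _ (by omega))⟩
end
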